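/- Let m₀ ∈ 𝒫(ℝ^{2d}) be a polynomially moderate weight and (ψ, φ) m₀-admissible weights, i.e. m(x,ω) = sqrt(m₀(x,ω)² + |ψ(x)|² + |φ(ω)|²) is polynomially moderate and m₀/m ∈ L^∞₀(ℝ^{2d}). Then for a fixed window g ∈ 𝒮(ℝ^d)\{0}, the norm ‖f‖_{M²_m} is equivalent to the norm ‖f‖ defined by ‖f‖² = ‖f‖²_{M²_{m₀}} + ‖ψ f‖²_{L²(ℝ^d)} + ‖φ f̂‖²_{L²(ℝ^d)}. -/

import Mathlib

open MeasureTheory Filter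
open scoped FourierTransform RealInnerProductSpace ENNReal

/-- A weight on phase space `ℝ^d × ℝ^d` belonging to the class `𝒫`: continuous, positive,
and `v`-moderate for some polynomial weight `v(w) = C(1+‖w‖)^N`. -/
def IsPolyModerateWeight (d : ℕ)
    (m : EuclideanSpace ℝ (Fin d) × EuclideanSpace ℝ (Fin d) → ℝ) : Prop :=
  Continuous m ∧ (∀ z, 0 < m z) ∧
    ∃ C N : ℝ, 0 < C ∧ 0 ≤ N ∧ ∀ z w, m (z + w) ≤ C * m z * (1 + ‖w‖) ^ N

/-- The short-time Fourier transform `V_g f(x,ω) = ∫ f(t) conj(g(t−x)) e^{−2πi t·ω} dt`. -/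
noncomputable def stft (d : ℕ) (g f : EuclideanSpace ℝ (Fin d) → ℂ)
    (x ω : EuclideanSpace ℝ (Fin d)) : ℂ :=
  ∫ t : EuclideanSpace ℝ (Fin d),
    f t * (starRingEnd ℂ) (g (t - x)) *
      Complex.exp (-(2 * (Real.pi : ℂ) * Complex.I * ((⟪t, ω⟫ : ℝ) : ℂ)))

/-- The weighted modulation space norm
`‖f‖_{M²_μ} = (∬ |μ(x,ω) V_g f(x,ω)|² dx dω)^{1/2}` with window `g`. -/
noncomputable def modNorm2 (d : ℕ) (g : EuclideanSpace ℝ (Fin d) → ℂ)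
    (μ : EuclideanSpace ℝ (Fin d) × EuclideanSpace ℝ (Fin d) → ℝ)
    (f : EuclideanSpace ℝ (Fin d) → ℂ) : ℝ≥0∞ :=
  (∫⁻ x : EuclideanSpace ℝ (Fin d), ∫⁻ ω : EuclideanSpace ℝ (Fin d),
      ENNReal.ofReal (μ (x, ω) * ‖stft d g f x ω‖) ^ (2 : ℝ)) ^ (1 / (2 : ℝ))

open MeasureTheory Filter
open scoped FourierTransform RealInnerProductSpace ENNReal

section Planch
variable {E : Type*} [NormedAddCommGroup E] [InnerProductSpace ℝ E] [FiniteDimensional ℝ E]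
  [MeasurableSpace E] [BorelSpace E]

lemma ae_eq_of_schwartz_test {p q : E → ℂ} (hp : LocallyIntegrable p) (hq : LocallyIntegrable q)
    (h : ∀ η : SchwartzMap E ℂ, ∫ x, η x • p x = ∫ x, η x • q x) : p =ᵐ[volume] q := by
  apply ae_eq_of_integral_contDiff_smul_eq hp hq
  intro g g_smooth g_cpt
  have hg₁ : HasCompactSupport (Complex.ofRealCLM ∘ g) := g_cpt.comp_left rfl
  have hg₂ : ContDiff ℝ (⊤ : ℕ∞) (Complex.ofRealCLM ∘ g) := by fun_prop
  have := h (hg₁.toSchwartzMap hg₂)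
  simpa using this

lemma integral_schwartz_fourier (f : E → ℂ) (hf : Integrable f) (η : SchwartzMap E ℂ) :
    ∫ x, (𝓕 η) x • f x = ∫ x, η x • 𝓕 f x := by
  have := VectorFourier.integral_fourierIntegral_smul_eq_flip (L := innerₗ E)
      Real.continuous_fourierChar continuous_inner (η.integrable (μ := volume)) hf
  simpa [SchwartzMap.fourier_coe] using! this

lemma fourier_continuous_of_integrable (f : E → ℂ) (hf : Integrable f) : Continuous (𝓕 f) :=
  VectorFourier.fourierIntegral_continuous Real.continuous_fourierChar
    (L := innerₗ E) continuous_inner hf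

lemma plancherel_aux (f : E → ℂ) (hf : Integrable f) (h2 : MemLp f 2) :
    eLpNorm (𝓕 f) 2 volume = eLpNorm f 2 volume := by
  set h : Lp ℂ 2 (volume : Measure E) := 𝓕 (h2.toLp f) with hh
  have key : (h : E → ℂ) =ᵐ[volume] 𝓕 f := by
    apply ae_eq_of_schwartz_test
    · exact (Lp.memLp h).locallyIntegrable one_le_two
    · exact (fourier_continuous_of_integrable f hf).locallyIntegrable
    · intro η
      rw [← Lp.toTemperedDistribution_apply, hh, ← Lp.fourier_toTemperedDistribution_eq,
        TemperedDistribution.fourier_apply, Lp.toTemperedDistribution_apply,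
        ← integral_schwartz_fourier f hf]
      apply integral_congr_ae
      filter_upwards [h2.coeFn_toLp] with x hx
      rw [hx]
  rw [← eLpNorm_congr_ae key, ← Lp.enorm_def, ← eLpNorm_congr_ae h2.coeFn_toLp, ← Lp.enorm_def,
    ← ofReal_norm, ← ofReal_norm, hh, Lp.norm_fourier_eq]

lemma plancherel_L1 (f : E → ℂ) (hf : Integrable f) :
    eLpNorm (𝓕 f) 2 volume = eLpNorm f 2 volume := by
  by_cases h2 : MemLp f 2
  · exact plancherel_aux f hf h2
  by_cases h3 : MemLp (𝓕 f) 2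
  · exfalso
    apply h2
    set h : Lp ℂ 2 (volume : Measure E) := 𝓕⁻ (h3.toLp _) with hh
    have key : (h : E → ℂ) =ᵐ[volume] f := by
      apply ae_eq_of_schwartz_test
      · exact (Lp.memLp h).locallyIntegrable one_le_two
      · exact hf.locallyIntegrable
      · intro η
        rw [← Lp.toTemperedDistribution_apply, hh, ← Lp.fourierInv_toTemperedDistribution_eq,
          TemperedDistribution.fourierInv_apply, Lp.toTemperedDistribution_apply]
        have : ∫ x, (𝓕⁻ η) x • (h3.toLp _ : E → ℂ) x = ∫ x, (𝓕⁻ η) x • 𝓕 f x := by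
          apply integral_congr_ae
          filter_upwards [h3.coeFn_toLp] with x hx
          rw [hx]
        rw [this, ← integral_schwartz_fourier f hf, FourierTransform.fourier_fourierInv_eq]
    exact (memLp_congr_ae key).1 (Lp.memLp h)
  · have a1 : eLpNorm f 2 volume = ⊤ := by
      by_contra hne
      exact h2 ⟨hf.aestronglyMeasurable, lt_top_iff_ne_top.2 hne⟩
    have a2 : eLpNorm (𝓕 f) 2 volume = ⊤ := by
      by_contra hne
      exact h3 ⟨(fourier_continuous_of_integrable f hf).aestronglyMeasurable,
        lt_top_iff_ne_top.2 hne⟩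
    rw [a1, a2]

lemma eLpNorm_two_sq' (f : E → ℂ) :
    eLpNorm f 2 volume ^ 2 = ∫⁻ x, ‖f x‖ₑ ^ 2 := by
  rw [eLpNorm_eq_lintegral_rpow_enorm_toReal (by simp) (by simp), ← ENNReal.rpow_natCast,
    ← ENNReal.rpow_mul]
  norm_num

lemma plancherel_lintegral (f : E → ℂ) (hf : Integrable f) :
    ∫⁻ ξ, ‖𝓕 f ξ‖ₑ ^ 2 = ∫⁻ x, ‖f x‖ₑ ^ 2 := by
  rw [← eLpNorm_two_sq', ← eLpNorm_two_sq', plancherel_L1 f hf]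
end Planch

section STFT
variable {d : ℕ}


lemma stft_eq_fourier (g : SchwartzMap (EuclideanSpace ℝ (Fin d)) ℂ)
    (f : EuclideanSpace ℝ (Fin d) → ℂ) (x ω : EuclideanSpace ℝ (Fin d)) :
    stft d g f x ω = 𝓕 (fun t => f t * (starRingEnd ℂ) (g (t - x))) ω := by
  rw [Real.fourier_eq', stft]
  congr 1
  ext t
  rw [smul_eq_mul, mul_comm]
  congr 2
  push_cast
  ring

lemma integrable_window (g : SchwartzMap (EuclideanSpace ℝ (Fin d)) ℂ)
    (f : EuclideanSpace ℝ (Fin d) → ℂ) (hf : Integrable f) (x : EuclideanSpace ℝ (Fin d)) :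
    Integrable (fun t => f t * (starRingEnd ℂ) (g (t - x))) := by
  refine hf.mul_bdd (c := SchwartzMap.seminorm ℝ 0 0 g) ?_ ?_
  · have : Continuous (fun t => (starRingEnd ℂ) (g (t - x))) := by
      have := g.continuous
      fun_prop
    exact this.aestronglyMeasurable
  · filter_upwards with t
    simpa using g.norm_le_seminorm ℝ (t - x)

lemma stft_I1 (g : SchwartzMap (EuclideanSpace ℝ (Fin d)) ℂ)
    (f : EuclideanSpace ℝ (Fin d) → ℂ) (hf : Integrable f) (x : EuclideanSpace ℝ (Fin d)) :
    ∫⁻ ω, ‖stft d g f x ω‖ₑ ^ 2 = ∫⁻ t, ‖f t‖ₑ ^ 2 * ‖g (t - x)‖ₑ ^ 2 := by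
  simp_rw [stft_eq_fourier]
  rw [plancherel_lintegral _ (integrable_window g f hf x)]
  simp [mul_pow]

open Convolution in
lemma stft_I2 (g : SchwartzMap (EuclideanSpace ℝ (Fin d)) ℂ)
    (f : EuclideanSpace ℝ (Fin d) → ℂ) (hf : Integrable f) (ω : EuclideanSpace ℝ (Fin d)) :
    ∫⁻ x, ‖stft d g f x ω‖ₑ ^ 2 = ∫⁻ ξ, ‖𝓕 f ξ‖ₑ ^ 2 * ‖(𝓕 g) (ξ - ω)‖ₑ ^ 2 := by
  set fω : EuclideanSpace ℝ (Fin d) → ℂ := fun t => Real.fourierChar (-⟪t, ω⟫) • f t with hfω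
  set gs : EuclideanSpace ℝ (Fin d) → ℂ := fun y => (starRingEnd ℂ) (g (-y)) with hgs
  have ifω : Integrable fω := (Real.fourierIntegral_convergent_iff ω).2 hf
  have igs : Integrable gs := by
    have h1 : Integrable (fun y => g (-y)) := g.integrable.comp_neg
    exact (LinearIsometryEquiv.integrable_comp_iff (Complex.conjLIE)).2 h1
  have hV : ∀ x, stft d g f x ω = (fω ⋆[ContinuousLinearMap.mul ℂ ℂ] gs) x := by
    intro x
    rw [convolution_def, stft_eq_fourier, Real.fourier_eq]
    congr 1
    ext t
    simp [hfω, hgs, Circle.smul_def, mul_assoc]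
  have h1 : ∀ ξ, 𝓕 fω ξ = 𝓕 f (ξ + ω) := by
    intro ξ
    rw [Real.fourier_eq, Real.fourier_eq]
    congr 1
    ext t
    simp only [hfω, inner_add_right, neg_add, AddChar.map_add_eq_mul, smul_smul]
  have h2 : ∀ ξ, ‖𝓕 gs ξ‖ₑ = ‖(𝓕 g) ξ‖ₑ := by
    intro ξ
    have : 𝓕 gs ξ = (starRingEnd ℂ) ((𝓕 g) ξ) := by
      rw [SchwartzMap.fourier_coe, Real.fourier_eq, Real.fourier_eq, ← integral_conj,
        ← integral_neg_eq_self]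
      congr 1
      ext t
      simp [hgs, Circle.smul_def, Real.fourierChar_apply, ← Complex.exp_conj, Complex.conj_ofNat]
    rw [this]; simp
  simp_rw [hV]
  rw [← plancherel_lintegral _ (ifω.integrable_convolution _ igs)]
  simp_rw [Real.fourier_mul_convolution_eq ifω igs, enorm_mul, h1, h2, mul_pow]
  rw [← lintegral_sub_right_eq_self _ ω]
  simp

lemma stft_congr_ae (g f f' : EuclideanSpace ℝ (Fin d) → ℂ) (h : f =ᵐ[volume] f') :
    stft d g f = stft d g f' := by
  ext x ω
  apply integral_congr_ae
  filter_upwards [h] with t ht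
  rw [ht]

lemma stft_measurable (g : SchwartzMap (EuclideanSpace ℝ (Fin d)) ℂ)
    (f : EuclideanSpace ℝ (Fin d) → ℂ) (hf : Integrable f) :
    Measurable (fun z : EuclideanSpace ℝ (Fin d) × EuclideanSpace ℝ (Fin d) =>
      ‖stft d g f z.1 z.2‖ₑ ^ 2) := by
  obtain ⟨f', hf', hff⟩ := hf.aestronglyMeasurable
  rw [stft_congr_ae g f f' hff]
  have : StronglyMeasurable
    (fun p : (EuclideanSpace ℝ (Fin d) × EuclideanSpace ℝ (Fin d)) × EuclideanSpace ℝ (Fin d) =>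
      f' p.2 * (starRingEnd ℂ) (g (p.2 - p.1.1)) *
      Complex.exp (-(2 * (Real.pi : ℂ) * Complex.I * ((⟪p.2, p.1.2⟫ : ℝ) : ℂ)))) := by
    refine ((hf'.comp_measurable measurable_snd).mul ?_).mul ?_
    · have := g.continuous
      exact Continuous.stronglyMeasurable (by fun_prop)
    · exact Continuous.stronglyMeasurable (by fun_prop)
  have h2 := this.integral_prod_right' (ν := (volume : Measure (EuclideanSpace ℝ (Fin d))))
  exact (h2.measurable.enorm).pow_const 2
end STFT

set_option linter.unusedSectionVars false
set_option linter.unusedVariables false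

section Weights
variable {E : Type*} [NormedAddCommGroup E] [ProperSpace E]

lemma weight_W1 (P Q : E → ℝ) (M : E → E → ℝ) (K R : ℝ) (n : ℕ)
    (hMc : Continuous (fun x => M x 0)) (hK : 0 ≤ K)
    (hP : ∀ x, 0 ≤ P x) (hQ : ∀ x, 0 ≤ Q x) (hPM : ∀ x ω, P x ≤ M x ω)
    (hmod : ∀ x y ω, M x ω ≤ K * (1 + ‖x - y‖) ^ n * M y ω)
    (hinf : ∀ x ω, R ≤ ‖x‖ → M x ω ≤ 2 * (P x + Q ω)) :
    ∃ K' : ℝ, 0 ≤ K' ∧ ∀ x t, P x ≤ K' * (1 + ‖x - t‖) ^ n * (P t + 1) := by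
  obtain ⟨B, hB⟩ := (isCompact_closedBall (0 : E) R).bddAbove_image hMc.continuousOn
  have hb : ∀ t, M t 0 ≤ (|B| + 2 + 2 * Q 0) * (P t + 1) := by
    intro t
    have h1 := hP t
    have h2 := hQ 0
    have h3 := abs_nonneg B
    rcases le_total R ‖t‖ with h | h
    · have := hinf t 0 h
      nlinarith [mul_nonneg h1 h2, mul_nonneg h3 h1]
    · have := hB (Set.mem_image_of_mem _ (show t ∈ Metric.closedBall (0 : E) R by simpa using h))
      have h4 := le_abs_self B
      nlinarith [mul_nonneg h1 h2, mul_nonneg h3 h1]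
  refine ⟨K * (|B| + 2 + 2 * Q 0), ?_, ?_⟩
  · have h2 := hQ 0
    positivity
  · intro x t
    calc P x ≤ M x 0 := hPM x 0
      _ ≤ K * (1 + ‖x - t‖) ^ n * M t 0 := hmod x t 0
      _ ≤ K * (1 + ‖x - t‖) ^ n * ((|B| + 2 + 2 * Q 0) * (P t + 1)) := by
        gcongr
        exact hb t
      _ = _ := by ring

lemma weight_W2 (P Q : E → ℝ) (M : E → E → ℝ) (K R : ℝ) (n : ℕ)
    (hQc : Continuous Q) (hK : 0 < K) (hR : 0 ≤ R)
    (hP : ∀ x, 0 ≤ P x) (hQ : ∀ x, 0 ≤ Q x)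
    (hPM : ∀ x ω, P x ≤ M x ω) (hQM : ∀ x ω, Q ω ≤ M x ω)
    (hmod : ∀ x y ω, M x ω ≤ K * (1 + ‖x - y‖) ^ n * M y ω)
    (hmod' : ∀ x ω η, M x ω ≤ K * (1 + ‖ω - η‖) ^ n * M x η)
    (hinf : ∀ x ω, R ≤ ‖x‖ → M x ω ≤ 2 * (P x + Q ω))
    (hinf' : ∀ x ω, R ≤ ‖ω‖ → M x ω ≤ 2 * (P x + Q ω)) :
    (∃ K' : ℝ, 0 ≤ K' ∧ ∀ x t, P x ≤ K' * (1 + ‖x - t‖) ^ n * P t) ∨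
    (∃ p : ℝ, 0 < p ∧ ∀ ω, p ≤ Q ω) ∨
    (∃ c R' : ℝ, 0 < c ∧ ∀ x, R' ≤ ‖x‖ → c ≤ P x ∧ c ≤ Q x) := by
  by_cases h2 : ∀ ε > 0, ∃ ω, R ≤ ‖ω‖ ∧ Q ω < ε
  · left
    refine ⟨2 * K, by positivity, fun x t => ?_⟩
    set L := 2 * K * (1 + ‖x - t‖) ^ n with hL
    have hLp : 0 < L := by positivity
    apply le_of_forall_pos_le_add
    intro ε hε
    obtain ⟨ω, h3, h4⟩ := h2 (ε / L) (by positivity)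
    calc P x ≤ M x ω := hPM x ω
      _ ≤ K * (1 + ‖x - t‖) ^ n * M t ω := hmod x t ω
      _ ≤ K * (1 + ‖x - t‖) ^ n * (2 * (P t + ε / L)) := by
        gcongr
        exact (hinf' t ω h3).trans (by linarith)
      _ = L * P t + L * (ε / L) := by rw [hL]; ring
      _ = L * P t + ε := by rw [mul_div_cancel₀ _ hLp.ne']
  · right
    push Not at h2
    obtain ⟨ε, hε, h2⟩ := h2
    obtain ⟨ω0, -, h0⟩ := (isCompact_closedBall (0 : E) R).exists_isMinOn
      ⟨0, by simpa using hR⟩ hQc.continuousOn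
    by_cases h3 : 0 < Q ω0
    · left
      refine ⟨min ε (Q ω0), lt_min hε h3, fun ω => ?_⟩
      rcases le_total R ‖ω‖ with h | h
      · exact (min_le_left _ _).trans (h2 ω h)
      · exact (min_le_right _ _).trans (h0 (show ω ∈ Metric.closedBall (0 : E) R by simpa using h))
    · right
      have h4 : Q ω0 = 0 := le_antisymm (not_lt.1 h3) (hQ _)
      by_cases h5 : ∃ ω1 : E, R ≤ ‖ω1‖
      · obtain ⟨ω1, h5⟩ := h5
        set L := 2 * K * (1 + ‖ω1 - ω0‖) ^ n with hL
        have hLp : 0 < L := by positivity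
        refine ⟨min ε (ε / L), R, by positivity, fun x hx => ⟨?_, ?_⟩⟩
        · refine (min_le_right _ _).trans ?_
          rw [div_le_iff₀ hLp]
          calc ε ≤ Q ω1 := h2 _ h5
            _ ≤ M x ω1 := hQM _ _
            _ ≤ K * (1 + ‖ω1 - ω0‖) ^ n * M x ω0 := hmod' _ _ _
            _ ≤ K * (1 + ‖ω1 - ω0‖) ^ n * (2 * (P x + Q ω0)) := by
              gcongr
              exact hinf _ _ hx
            _ = P x * L := by rw [h4, hL]; ring
        · exact (min_le_left _ _).trans (h2 x hx)
      · push Not at h5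
        exact ⟨1, R, one_pos, fun x hx => absurd hx (not_le.2 (h5 x))⟩
end Weights

section Abstract
variable {E : Type*} [NormedAddCommGroup E] [InnerProductSpace ℝ E] [FiniteDimensional ℝ E]
  [MeasurableSpace E] [BorelSpace E]

/-- polynomial weight -/
noncomputable def pw (n : ℕ) (y : E) : ℝ≥0∞ := ENNReal.ofReal ((1 + ‖y‖) ^ n)

lemma pw_measurable (n : ℕ) : Measurable (pw (E := E) n) := by
  unfold pw; fun_prop

lemma pw_ne_zero (n : ℕ) (y : E) : pw n y ≠ 0 := by
  unfold pw
  have : 0 < (1 + ‖y‖) ^ n := by positivity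
  simpa using this

lemma pw_ne_top (n : ℕ) (y : E) : pw n y ≠ ⊤ := by
  unfold pw; simp

lemma swap_I1 (p u k : E → ℝ≥0∞) (W : E → E → ℝ≥0∞) (hp : Measurable p) (hu : Measurable u)
    (hk : Measurable k) (hW : Measurable (Function.uncurry W))
    (I1 : ∀ x, ∫⁻ ω, W x ω = ∫⁻ t, u t * k (t - x)) :
    ∫⁻ x, ∫⁻ ω, p x * W x ω = ∫⁻ t, u t * ∫⁻ x, p x * k (t - x) := by
  have hW' : ∀ x, Measurable (W x) := fun x => hW.of_uncurry_left
  calc ∫⁻ x, ∫⁻ ω, p x * W x ω = ∫⁻ x, ∫⁻ t, u t * (p x * k (t - x)) := by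
        congr 1; ext x
        rw [lintegral_const_mul _ (hW' x), I1, ← lintegral_const_mul _ (by fun_prop)]
        congr 1; ext t; ring
    _ = ∫⁻ t, ∫⁻ x, u t * (p x * k (t - x)) := by
        rw [lintegral_lintegral_swap]
        apply Measurable.aemeasurable
        simp only [Function.uncurry_def]
        fun_prop
    _ = _ := by
        congr 1; ext t
        rw [lintegral_const_mul _ (by fun_prop)]

lemma upper_A (p b u k : E → ℝ≥0∞) (W : E → E → ℝ≥0∞) (K : ℝ≥0∞) (n : ℕ)
    (hp : Measurable p) (hb : Measurable b)
    (hu : Measurable u) (hk : Measurable k) (hW : Measurable (Function.uncurry W))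
    (I1 : ∀ x, ∫⁻ ω, W x ω = ∫⁻ t, u t * k (t - x))
    (hpb : ∀ x t, p x ≤ K * pw n (t - x) * b t) :
    ∫⁻ x, ∫⁻ ω, p x * W x ω ≤ K * (∫⁻ y, pw n y * k y) * ∫⁻ t, b t * u t := by
  rw [swap_I1 p u k W hp hu hk hW I1, ← lintegral_const_mul _ (by fun_prop)]
  have := pw_measurable (E := E) n
  refine lintegral_mono fun t => ?_
  calc u t * ∫⁻ x, p x * k (t - x) ≤ u t * ∫⁻ x, (K * b t) * (pw n (t - x) * k (t - x)) := by
        refine mul_le_mul_right (lintegral_mono fun x => ?_) _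
        calc p x * k (t - x) ≤ (K * pw n (t - x) * b t) * k (t - x) := by
              gcongr; exact hpb x t
          _ = _ := by ring
    _ = u t * ((K * b t) * ∫⁻ y, pw n y * k y) := by
        rw [lintegral_const_mul _ (by fun_prop),
          lintegral_sub_left_eq_self (fun y => pw n y * k y) t]
    _ = _ := by ring

lemma lower_A (p Ψ u k : E → ℝ≥0∞) (W : E → E → ℝ≥0∞) (K : ℝ≥0∞) (n : ℕ)
    (hp : Measurable p) (hΨ : Measurable Ψ)
    (hu : Measurable u) (hk : Measurable k) (hW : Measurable (Function.uncurry W))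
    (I1 : ∀ x, ∫⁻ ω, W x ω = ∫⁻ t, u t * k (t - x))
    (hpb : ∀ x t, p t ≤ K * pw n (t - x) * Ψ x) :
    (∫⁻ y, (pw n y)⁻¹ * k y) * ∫⁻ t, p t * u t ≤ K * ∫⁻ x, ∫⁻ ω, Ψ x * W x ω := by
  have := pw_measurable (E := E) n
  rw [swap_I1 Ψ u k W hΨ hu hk hW I1, ← lintegral_const_mul _ (by fun_prop),
    ← lintegral_const_mul]
  swap
  · apply hu.mul
    apply Measurable.lintegral_prod_right
    fun_prop
  refine lintegral_mono fun t => ?_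
  calc (∫⁻ y, (pw n y)⁻¹ * k y) * (p t * u t)
      = u t * ∫⁻ x, p t * ((pw n (t - x))⁻¹ * k (t - x)) := by
        rw [lintegral_const_mul _ (by fun_prop),
          lintegral_sub_left_eq_self (fun y => (pw n y)⁻¹ * k y) t]
        ring
    _ ≤ u t * ∫⁻ x, K * (Ψ x * k (t - x)) := by
        refine mul_le_mul_right (lintegral_mono fun x => ?_) _
        calc p t * ((pw n (t - x))⁻¹ * k (t - x))
            ≤ (K * pw n (t - x) * Ψ x) * ((pw n (t - x))⁻¹ * k (t - x)) := by
              gcongr; exact hpb x t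
          _ = (pw n (t - x) * (pw n (t - x))⁻¹) * (K * (Ψ x * k (t - x))) := by ring
          _ = _ := by rw [ENNReal.mul_inv_cancel (pw_ne_zero _ _) (pw_ne_top _ _), one_mul]
    _ = _ := by
        rw [lintegral_const_mul _ (by fun_prop)]
        ring

lemma exists_ball_pos (k : E → ℝ≥0∞) (hk : Measurable k) (h : ∫⁻ y, k y ≠ 0) :
    ∃ r : ℝ, ∫⁻ y in Metric.closedBall 0 r, k y ≠ 0 := by
  by_contra! hc
  apply h
  have h1 : (volume.withDensity k) (⋃ n : ℕ, Metric.closedBall (0 : E) n) = 0 := by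
    refine measure_iUnion_null fun n => ?_
    rw [withDensity_apply _ Metric.isClosed_closedBall.measurableSet]
    exact hc n
  rw [Metric.iUnion_closedBall_nat, withDensity_apply _ MeasurableSet.univ] at h1
  simpa using h1

lemma exists_tail_small (k : E → ℝ≥0∞) (h : ∫⁻ y, k y ≠ ⊤) (ε : ℝ≥0∞)
    (hε : ε ≠ 0) : ∃ r : ℝ, ∫⁻ y in (Metric.closedBall 0 r)ᶜ, k y ≤ ε := by
  have : Tendsto (fun n : ℕ => (volume.withDensity k) ((Metric.closedBall (0 : E) n)ᶜ)) atTop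
      (nhds ((volume.withDensity k) (⋂ n : ℕ, (Metric.closedBall (0 : E) n)ᶜ))) := by
    apply tendsto_measure_iInter_atTop
    · intro n
      exact Metric.isClosed_closedBall.measurableSet.compl.nullMeasurableSet
    · intro a b hab
      exact Set.compl_subset_compl.2 (Metric.closedBall_subset_closedBall (by exact_mod_cast hab))
    · refine ⟨0, ?_⟩
      rw [withDensity_apply _ Metric.isClosed_closedBall.measurableSet.compl]
      exact ((setLIntegral_le_lintegral _ _).trans_lt (lt_top_iff_ne_top.2 h)).ne
  rw [← Set.compl_iUnion, Metric.iUnion_closedBall_nat, Set.compl_univ, measure_empty] at this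
  obtain ⟨n, hn⟩ := (this.eventually (ge_mem_nhds (pos_iff_ne_zero.2 hε))).exists
  refine ⟨n, ?_⟩
  rwa [withDensity_apply _ Metric.isClosed_closedBall.measurableSet.compl] at hn

end Abstract

section Core
variable {E : Type*} [NormedAddCommGroup E] [InnerProductSpace ℝ E] [FiniteDimensional ℝ E]
  [MeasurableSpace E] [BorelSpace E]

lemma absorb (x y : ℝ≥0∞) (hx : x ≠ ⊤) (h : x ≤ y + x / 2) : x ≤ 2 * y := by
  have h1 : x / 2 + x / 2 ≤ y + x / 2 := by rwa [ENNReal.add_halves]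
  have h2 : x / 2 ≤ y := by
    refine (ENNReal.add_le_add_iff_right ?_).1 h1
    exact (ENNReal.div_lt_top hx (by simp)).ne
  calc x = 2 * (x / 2) := by rw [ENNReal.mul_div_cancel (by simp) (by simp)]
    _ ≤ _ := by gcongr

lemma tail_le (u P : E → ℝ≥0∞) (c : ℝ≥0∞) (R : ℝ) (hc0 : c ≠ 0) (hct : c ≠ ⊤)
    (hu : Measurable u)
    (hP : ∀ x, R ≤ ‖x‖ → c ≤ P x) :
    ∫⁻ x in (Metric.closedBall 0 R)ᶜ, u x ≤ c⁻¹ * ∫⁻ x, P x * u x := by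
  rw [← ENNReal.div_eq_inv_mul, ENNReal.le_div_iff_mul_le (Or.inl hc0) (Or.inl hct), mul_comm,
    ← lintegral_const_mul _ hu]
  calc ∫⁻ x in (Metric.closedBall 0 R)ᶜ, c * u x ≤ ∫⁻ x in (Metric.closedBall 0 R)ᶜ, P x * u x := by
        refine setLIntegral_mono' Metric.isClosed_closedBall.measurableSet.compl fun x hx => ?_
        gcongr
        apply hP
        simp at hx
        exact hx.le
    _ ≤ _ := setLIntegral_le_lintegral _ _

lemma core (A : E → E → ℝ≥0∞) (P Q k kh : E → ℝ≥0∞) (c : ℝ≥0∞) (R2 : ℝ)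
    (hk : Measurable k) (hkh : Measurable kh)
    (hk0 : ∫⁻ y, k y ≠ 0) (hkt : ∫⁻ y, k y ≠ ⊤) (hkht : ∫⁻ y, kh y ≠ ⊤)
    (hA : ∀ R : ℝ, ∃ a : ℝ≥0∞, a ≠ 0 ∧ a ≠ ⊤ ∧ ∀ x ω, ‖x‖ ≤ R → ‖ω‖ ≤ R → a ≤ A x ω)
    (hc0 : c ≠ 0) (hct : c ≠ ⊤)
    (hP : ∀ x, R2 ≤ ‖x‖ → c ≤ P x) (hQ : ∀ x, R2 ≤ ‖x‖ → c ≤ Q x) :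
    ∃ C : ℝ≥0∞, C ≠ ⊤ ∧ ∀ (u uh : E → ℝ≥0∞) (W : E → E → ℝ≥0∞), Measurable u → Measurable uh →
      Measurable (Function.uncurry W) →
      (∀ x, ∫⁻ ω, W x ω = ∫⁻ t, u t * k (t - x)) →
      (∀ ω, ∫⁻ x, W x ω = ∫⁻ ξ, uh ξ * kh (ξ - ω)) →
      ∫⁻ x, u x = ∫⁻ ξ, uh ξ → (∀ R : ℝ, ∫⁻ ξ in Metric.closedBall 0 R, uh ξ ≠ ⊤) →
      ∫⁻ x, u x ≤ C * ((∫⁻ x, ∫⁻ ω, A x ω * W x ω) + (∫⁻ x, P x * u x) + (∫⁻ ξ, Q ξ * uh ξ)) := by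
  obtain ⟨r, hr⟩ := exists_ball_pos k hk hk0
  set κ := ∫⁻ y in Metric.closedBall 0 r, k y with hκ
  have hκt : κ ≠ ⊤ := ((setLIntegral_le_lintegral _ _).trans_lt (lt_top_iff_ne_top.2 hkt)).ne
  obtain ⟨ρ, hρ⟩ := exists_tail_small kh hkht (κ / 2) (by simp [hr])
  set J := ∫⁻ y, kh y with hJ
  set R3 := R2 + r with hR3
  set R1 := R2 + ρ with hR1
  obtain ⟨a, ha0, hat, ha⟩ := hA (max R3 R1)
  set C0 := c⁻¹ + κ⁻¹ * (a⁻¹ + J * c⁻¹) with hC0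
  have hC0t : C0 ≠ ⊤ := by finiteness
  have hC00 : C0 ≠ 0 := by
    rw [hC0]; simp [hct]
  refine ⟨2 * C0, by finiteness, ?_⟩
  intro u uh W hu huh hW I1 I2 huu hfin
  have hW1 : ∀ x, Measurable (W x) := fun x => hW.of_uncurry_left
  set S := (∫⁻ x, ∫⁻ ω, A x ω * W x ω) + (∫⁻ x, P x * u x) + (∫⁻ ξ, Q ξ * uh ξ) with hS
  have S1 : ∫⁻ x, ∫⁻ ω, A x ω * W x ω ≤ S := by rw [hS, add_assoc]; exact le_self_add
  have S2 : ∫⁻ x, P x * u x ≤ S := by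
    rw [hS]; exact le_add_self.trans le_self_add
  have S3 : ∫⁻ ξ, Q ξ * uh ξ ≤ S := by rw [hS]; exact le_add_self
  by_cases hSt : S = ⊤
  · rw [hSt, ENNReal.mul_top (by simp [hC00])]; exact le_top
  have mB : ∀ R : ℝ, MeasurableSet (Metric.closedBall (0 : E) R) :=
    fun R => Metric.isClosed_closedBall.measurableSet
  have hsplit : ∀ (v : E → ℝ≥0∞) (R : ℝ), ∫⁻ x, v x =
      (∫⁻ x in Metric.closedBall 0 R, v x) + ∫⁻ x in (Metric.closedBall 0 R)ᶜ, v x :=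
    fun v R => (lintegral_add_compl v (mB R)).symm
  have tu : ∫⁻ x in (Metric.closedBall 0 R2)ᶜ, u x ≤ c⁻¹ * S :=
    (tail_le u P c R2 hc0 hct hu hP).trans (by gcongr)
  have tuh : ∫⁻ x in (Metric.closedBall 0 R2)ᶜ, uh x ≤ c⁻¹ * S :=
    (tail_le uh Q c R2 hc0 hct huh hQ).trans (by gcongr)
  have hut : ∫⁻ x, u x ≠ ⊤ := by
    rw [huu, hsplit uh R2]
    refine ENNReal.add_ne_top.2 ⟨hfin R2, ?_⟩
    exact ne_top_of_le_ne_top (by finiteness) tuh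
  apply le_trans (absorb _ (C0 * S) hut ?_) (by rw [mul_assoc])
  -- step (a)
  have ea : κ * ∫⁻ x in Metric.closedBall 0 R2, u x ≤
      ∫⁻ x in Metric.closedBall 0 R3, ∫⁻ ω, W x ω := by
    have e1 : ∫⁻ x in Metric.closedBall 0 R3, ∫⁻ ω, W x ω =
        ∫⁻ x, ∫⁻ ω, (Metric.closedBall (0 : E) R3).indicator 1 x * W x ω := by
      rw [← lintegral_indicator (mB R3)]
      congr 1; ext x
      rw [lintegral_const_mul _ (hW1 x)]
      by_cases hx : x ∈ Metric.closedBall (0 : E) R3 <;> simp [Set.indicator, hx]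
    rw [e1, swap_I1 _ u k W (measurable_one.indicator (mB R3)) hu hk hW I1,
      ← lintegral_const_mul _ hu]
    refine le_trans ?_ (setLIntegral_le_lintegral (Metric.closedBall 0 R2) _)
    refine setLIntegral_mono' (mB R2) fun t ht => ?_
    rw [mul_comm]
    gcongr
    rw [← lintegral_sub_left_eq_self _ t, hκ, ← lintegral_indicator (mB r)]
    refine lintegral_mono fun y => ?_
    by_cases hy : y ∈ Metric.closedBall (0 : E) r
    · have : t - y ∈ Metric.closedBall (0 : E) R3 := by
        simp only [mem_closedBall_zero_iff] at *
        exact (norm_sub_le _ _).trans (by linarith)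
      rw [Set.indicator_of_mem hy, Set.indicator_of_mem this]
      simp
    · rw [Set.indicator_of_notMem hy]; exact bot_le
  -- step (b)
  have eb : ∫⁻ x in Metric.closedBall 0 R3, ∫⁻ ω, W x ω =
      (∫⁻ x in Metric.closedBall 0 R3, ∫⁻ ω in Metric.closedBall 0 R1, W x ω) +
      ∫⁻ x in Metric.closedBall 0 R3, ∫⁻ ω in (Metric.closedBall 0 R1)ᶜ, W x ω := by
    rw [← lintegral_add_left]
    · congr 1; ext x
      exact hsplit (W x) R1
    · exact hW.lintegral_prod_right'
  have eb1 : ∫⁻ x in Metric.closedBall 0 R3, ∫⁻ ω in Metric.closedBall 0 R1, W x ω ≤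
      a⁻¹ * S := by
    rw [← ENNReal.div_eq_inv_mul, ENNReal.le_div_iff_mul_le (Or.inl ha0) (Or.inl hat), mul_comm,
      ← lintegral_const_mul _ (show Measurable fun x => ∫⁻ ω in Metric.closedBall 0 R1, W x ω
        from hW.lintegral_prod_right')]
    refine le_trans ?_ S1
    refine le_trans ?_ (setLIntegral_le_lintegral (Metric.closedBall 0 R3) _)
    refine setLIntegral_mono' (mB R3) fun x hx => ?_
    rw [← lintegral_const_mul _ (hW1 x)]
    refine le_trans ?_ (setLIntegral_le_lintegral (Metric.closedBall 0 R1) _)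
    refine setLIntegral_mono' (mB R1) fun ω hω => ?_
    gcongr
    simp only [mem_closedBall_zero_iff] at hx hω
    exact ha x ω (hx.trans (le_max_left _ _)) (hω.trans (le_max_right _ _))
  have eb2 : ∫⁻ x in Metric.closedBall 0 R3, ∫⁻ ω in (Metric.closedBall 0 R1)ᶜ, W x ω ≤
      κ / 2 * (∫⁻ x, u x) + J * (c⁻¹ * S) := by
    have hW' : Measurable (Function.uncurry fun ω x => W x ω) := hW.comp measurable_swap
    calc _ ≤ ∫⁻ x, ∫⁻ ω in (Metric.closedBall 0 R1)ᶜ, W x ω := setLIntegral_le_lintegral _ _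
      _ = ∫⁻ ω in (Metric.closedBall 0 R1)ᶜ, ∫⁻ x, W x ω :=
          lintegral_lintegral_swap hW.aemeasurable
      _ = ∫⁻ ω, ∫⁻ x, ((Metric.closedBall (0 : E) R1)ᶜ).indicator 1 ω * W x ω := by
          rw [← lintegral_indicator (mB R1).compl]
          congr 1; ext ω
          rw [lintegral_const_mul _ hW'.of_uncurry_left]
          by_cases hx : ω ∈ (Metric.closedBall (0 : E) R1)ᶜ
          · rw [Set.indicator_of_mem hx, Set.indicator_of_mem hx]; simp
          · rw [Set.indicator_of_notMem hx, Set.indicator_of_notMem hx]; simp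
      _ = ∫⁻ ξ, uh ξ * ∫⁻ ω, ((Metric.closedBall (0 : E) R1)ᶜ).indicator 1 ω * kh (ξ - ω) :=
          swap_I1 _ uh kh (fun ω x => W x ω) (measurable_one.indicator (mB R1).compl) huh hkh hW' I2
      _ ≤ (∫⁻ ξ in Metric.closedBall 0 R2, (κ / 2) * uh ξ) +
          ∫⁻ ξ in (Metric.closedBall 0 R2)ᶜ, J * uh ξ := by
          rw [hsplit _ R2]
          refine add_le_add ?_ ?_
          · refine setLIntegral_mono' (mB R2) fun ξ hξ => ?_
            rw [mul_comm]
            gcongr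
            refine le_trans ?_ hρ
            rw [← lintegral_sub_left_eq_self _ ξ, ← lintegral_indicator (mB ρ).compl]
            refine lintegral_mono fun y => ?_
            by_cases hy : y ∈ (Metric.closedBall (0 : E) ρ)ᶜ
            · rw [Set.indicator_of_mem hy]
              by_cases h : ξ - y ∈ (Metric.closedBall (0 : E) R1)ᶜ
              · rw [Set.indicator_of_mem h]; simp
              · rw [Set.indicator_of_notMem h]; simp
            · have : ξ - y ∉ (Metric.closedBall (0 : E) R1)ᶜ := by
                simp only [Set.mem_compl_iff, not_not, mem_closedBall_zero_iff] at *
                exact (norm_sub_le _ _).trans (by linarith)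
              rw [Set.indicator_of_notMem this]; simp
          · refine setLIntegral_mono' (mB R2).compl fun ξ hξ => ?_
            rw [mul_comm]
            gcongr
            rw [hJ, ← lintegral_sub_left_eq_self kh ξ]
            refine lintegral_mono fun y => ?_
            by_cases h : y ∈ (Metric.closedBall (0 : E) R1)ᶜ
            · rw [Set.indicator_of_mem h]; simp
            · rw [Set.indicator_of_notMem h]; simp
      _ ≤ _ := by
          rw [lintegral_const_mul _ huh, lintegral_const_mul _ huh, huu]
          gcongr
          exact Measure.restrict_le_self
  have ec : ∫⁻ x in Metric.closedBall 0 R2, u x ≤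
      κ⁻¹ * (a⁻¹ * S + (κ / 2 * (∫⁻ x, u x) + J * (c⁻¹ * S))) := by
    rw [← ENNReal.div_eq_inv_mul, ENNReal.le_div_iff_mul_le (Or.inl hr) (Or.inl hκt), mul_comm]
    refine ea.trans ?_
    rw [eb]
    gcongr
  have hκκ : κ⁻¹ * (κ / 2 * ∫⁻ x, u x) = (∫⁻ x, u x) / 2 := by
    rw [ENNReal.div_eq_inv_mul, ENNReal.div_eq_inv_mul]
    calc _ = (κ * κ⁻¹) * (2⁻¹ * ∫⁻ x, u x) := by ring
      _ = _ := by rw [ENNReal.mul_inv_cancel hr hκt, one_mul]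
  calc ∫⁻ x, u x ≤ κ⁻¹ * (a⁻¹ * S + (κ / 2 * (∫⁻ x, u x) + J * (c⁻¹ * S))) + c⁻¹ * S := by
        conv_lhs => rw [hsplit u R2]
        gcongr
    _ = C0 * S + κ⁻¹ * (κ / 2 * ∫⁻ x, u x) := by rw [hC0]; ring
    _ = _ := by rw [hκκ]

end Core

section Concrete
variable {d : ℕ}

lemma half1 {E : Type*} [NormedAddCommGroup E] [InnerProductSpace ℝ E] [FiniteDimensional ℝ E]
    [MeasurableSpace E] [BorelSpace E] (P : E → ℝ) (hP : ∀ x, 0 ≤ P x) (hPc : Continuous P)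
    (u k : E → ℝ≥0∞) (W : E → E → ℝ≥0∞) (K : ℝ) (n : ℕ) (S : ℝ≥0∞)
    (hu : Measurable u) (hk : Measurable k) (hW : Measurable (Function.uncurry W))
    (I1 : ∀ x, ∫⁻ ω, W x ω = ∫⁻ t, u t * k (t - x)) (hK : 0 ≤ K)
    (hmod : ∀ x t, P x ≤ K * (1 + ‖x - t‖) ^ n * P t)
    (hS : ∫⁻ x, ENNReal.ofReal (P x) * u x ≤ S) :
    ∫⁻ x, ∫⁻ ω, ENNReal.ofReal (P x) * W x ω ≤
      ENNReal.ofReal K * (∫⁻ y, pw n y * k y) * S := by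
  refine (upper_A (fun x => ENNReal.ofReal (P x)) (fun x => ENNReal.ofReal (P x)) u k W
    (ENNReal.ofReal K) n (by fun_prop) (by fun_prop) hu hk hW I1 ?_).trans (by gcongr)
  intro x t
  rw [pw, ← ENNReal.ofReal_mul hK, ← ENNReal.ofReal_mul (by positivity), norm_sub_rev]
  exact ENNReal.ofReal_le_ofReal (hmod x t)

lemma half2 {E : Type*} [NormedAddCommGroup E] [InnerProductSpace ℝ E] [FiniteDimensional ℝ E]
    [MeasurableSpace E] [BorelSpace E] (P : E → ℝ) (hP : ∀ x, 0 ≤ P x) (hPc : Continuous P)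
    (u k : E → ℝ≥0∞) (W : E → E → ℝ≥0∞) (K : ℝ) (n : ℕ) (S C : ℝ≥0∞)
    (hu : Measurable u) (hk : Measurable k) (hW : Measurable (Function.uncurry W))
    (I1 : ∀ x, ∫⁻ ω, W x ω = ∫⁻ t, u t * k (t - x)) (hK : 0 ≤ K)
    (hmod : ∀ x t, P x ≤ K * (1 + ‖x - t‖) ^ n * (P t + 1))
    (hS : ∫⁻ x, ENNReal.ofReal (P x) * u x ≤ S) (hS' : ∫⁻ x, u x ≤ C * S) :
    ∫⁻ x, ∫⁻ ω, ENNReal.ofReal (P x) * W x ω ≤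
      ENNReal.ofReal K * (∫⁻ y, pw n y * k y) * (1 + C) * S := by
  refine (upper_A (fun x => ENNReal.ofReal (P x)) (fun x => ENNReal.ofReal (P x + 1)) u k W
    (ENNReal.ofReal K) n (by fun_prop) (by fun_prop) hu hk hW I1 ?_).trans ?_
  · intro x t
    rw [pw, ← ENNReal.ofReal_mul hK, ← ENNReal.ofReal_mul (by positivity), norm_sub_rev]
    exact ENNReal.ofReal_le_ofReal (hmod x t)
  · rw [mul_assoc _ (1 + C)]
    gcongr
    have : ∀ x, ENNReal.ofReal (P x + 1) * u x = ENNReal.ofReal (P x) * u x + u x := by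
      intro x
      rw [ENNReal.ofReal_add (hP x) zero_le_one]; simp [add_mul]
    simp_rw [this]
    rw [lintegral_add_right _ hu, add_mul, one_mul]
    gcongr

lemma lowerhalf {E : Type*} [NormedAddCommGroup E] [InnerProductSpace ℝ E] [FiniteDimensional ℝ E]
    [MeasurableSpace E] [BorelSpace E] (P : E → ℝ) (hPc : Continuous P)
    (M : E → E → ℝ) (hMc : ∀ ω, Continuous (fun x => M x ω))
    (hPM : ∀ x ω, P x ≤ M x ω)
    (u k : E → ℝ≥0∞) (W : E → E → ℝ≥0∞) (K : ℝ) (n : ℕ)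
    (hu : Measurable u) (hk : Measurable k) (hW : Measurable (Function.uncurry W))
    (I1 : ∀ x, ∫⁻ ω, W x ω = ∫⁻ t, u t * k (t - x)) (hK : 0 ≤ K)
    (hk0 : ∫⁻ y, k y ≠ 0) (hkt : ∫⁻ y, pw n y * k y ≠ ⊤)
    (hmod : ∀ x y ω, M x ω ≤ K * (1 + ‖x - y‖) ^ n * M y ω) :
    ∫⁻ x, ENNReal.ofReal (P x) * u x ≤ (∫⁻ y, (pw n y)⁻¹ * k y)⁻¹ * ENNReal.ofReal K *
      ∫⁻ x, ∫⁻ ω, ENNReal.ofReal (M x ω) * W x ω := by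
  have hΨ : Measurable (fun x => ⨅ ω, ENNReal.ofReal (M x ω)) := by
    apply UpperSemicontinuous.measurable
    apply upperSemicontinuous_iInf
    intro ω
    exact (ENNReal.continuous_ofReal.comp (hMc ω)).upperSemicontinuous
  have h := lower_A (fun x => ENNReal.ofReal (P x)) _ u k W (ENNReal.ofReal K) n
    (by fun_prop) hΨ hu hk hW I1 ?_
  · have h0 : ∫⁻ y, (pw n y)⁻¹ * k y ≠ 0 := by
      intro h0
      apply hk0
      have := pw_measurable (E := E) n
      rw [lintegral_eq_zero_iff (by fun_prop)] at h0
      rw [lintegral_eq_zero_iff hk]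
      filter_upwards [h0] with y hy
      simpa [pw_ne_top] using hy
    have ht : ∫⁻ y, (pw n y)⁻¹ * k y ≠ ⊤ := by
      refine ne_top_of_le_ne_top hkt (lintegral_mono fun y => ?_)
      gcongr
      have : 1 ≤ pw n y := by
        rw [pw, ENNReal.one_le_ofReal]
        exact one_le_pow₀ (by linarith [norm_nonneg y])
      exact (ENNReal.inv_le_one.2 this).trans this
    rw [mul_assoc, ← ENNReal.div_eq_inv_mul, ENNReal.le_div_iff_mul_le (Or.inl h0) (Or.inl ht),
      mul_comm]
    refine h.trans ?_
    refine mul_le_mul_right (lintegral_mono fun x => lintegral_mono fun ω => ?_) _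
    exact mul_le_mul_left (iInf_le _ ω) _
  · intro x t
    by_cases hn : ENNReal.ofReal K * pw n (t - x) = 0
    · rcases mul_eq_zero.1 hn with h | h
      · have hK0 : K = 0 := le_antisymm (by simpa using h) hK
        have h1 := hmod t x 0
        have h2 := hPM t 0
        rw [hK0] at h1
        have : P t ≤ 0 := by linarith
        simp [ENNReal.ofReal_of_nonpos this]
      · exact absurd h (pw_ne_zero _ _)
    rw [ENNReal.mul_iInf_of_ne hn (ENNReal.mul_ne_top (by simp) (pw_ne_top _ _))]
    refine le_iInf fun ω => ?_
    rw [pw, ← ENNReal.ofReal_mul hK, ← ENNReal.ofReal_mul (by positivity)]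
    exact ENNReal.ofReal_le_ofReal ((hPM t ω).trans (hmod t x ω))

lemma schwartz_J {E : Type*} [NormedAddCommGroup E] [InnerProductSpace ℝ E] [FiniteDimensional ℝ E]
    [MeasurableSpace E] [BorelSpace E] (g : SchwartzMap E ℂ) (n : ℕ) :
    ∫⁻ y, pw n y * ‖g y‖ₑ ^ 2 ≠ ⊤ := by
  set B := SchwartzMap.seminorm ℝ 0 0 g with hB
  have hB0 : 0 ≤ B := by positivity
  have hi : Integrable (fun y => B * 2 ^ (n - 1) * (‖y‖ ^ 0 * ‖g y‖ + ‖y‖ ^ n * ‖g y‖)) :=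
    ((g.integrable_pow_mul volume 0).add (g.integrable_pow_mul volume n)).const_mul _
  refine ne_top_of_le_ne_top hi.lintegral_lt_top.ne (lintegral_mono fun y => ?_)
  rw [pw, ← ofReal_norm, ← ENNReal.ofReal_pow (norm_nonneg _), ← ENNReal.ofReal_mul (by positivity)]
  apply ENNReal.ofReal_le_ofReal
  have h1 : ‖g y‖ ≤ B := g.norm_le_seminorm ℝ y
  have h2 : (1 + ‖y‖) ^ n ≤ 2 ^ (n - 1) * (1 ^ n + ‖y‖ ^ n) :=
    add_pow_le zero_le_one (norm_nonneg y) n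
  calc (1 + ‖y‖) ^ n * ‖g y‖ ^ 2 = (1 + ‖y‖) ^ n * (‖g y‖ * ‖g y‖) := by ring
    _ ≤ (2 ^ (n - 1) * (1 ^ n + ‖y‖ ^ n)) * (B * ‖g y‖) := by gcongr
    _ = _ := by ring

lemma schwartz_k0 {E : Type*} [NormedAddCommGroup E] [InnerProductSpace ℝ E] [FiniteDimensional ℝ E]
    [MeasurableSpace E] [BorelSpace E] (g : SchwartzMap E ℂ) (hg : g ≠ 0) :
    ∫⁻ y, ‖g y‖ₑ ^ 2 ≠ 0 := by
  intro h
  apply hg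
  have hc := g.continuous
  rw [lintegral_eq_zero_iff (by fun_prop)] at h
  have : (g : E → ℂ) =ᵐ[volume] 0 := by
    filter_upwards [h] with y hy
    simpa using hy
  have h2 := Continuous.ae_eq_iff_eq volume hc continuous_zero |>.1 this
  ext y
  exact congrFun h2 y

lemma moderate_sq (m : EuclideanSpace ℝ (Fin d) × EuclideanSpace ℝ (Fin d) → ℝ)
    (hm : IsPolyModerateWeight d m) : ∃ (K : ℝ) (n : ℕ), 0 < K ∧
      ∀ z w, m (z + w) ^ 2 ≤ K * (1 + ‖w‖) ^ n * m z ^ 2 := by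
  obtain ⟨-, hpos, C, N, hC, hN, h⟩ := hm
  refine ⟨C ^ 2, ⌈N⌉₊ * 2, by positivity, fun z w => ?_⟩
  have h1 : m (z + w) ≤ C * m z * (1 + ‖w‖) ^ ⌈N⌉₊ := by
    refine (h z w).trans ?_
    have := hpos z
    gcongr
    rw [← Real.rpow_natCast]
    exact Real.rpow_le_rpow_of_exponent_le (by linarith [norm_nonneg w]) (Nat.le_ceil N)
  calc m (z + w) ^ 2 ≤ (C * m z * (1 + ‖w‖) ^ ⌈N⌉₊) ^ 2 := by
        have := hpos (z + w)
        gcongr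
    _ = _ := by rw [pow_mul]; ring

lemma modNorm2_sq (g f : EuclideanSpace ℝ (Fin d) → ℂ)
    (μ : EuclideanSpace ℝ (Fin d) × EuclideanSpace ℝ (Fin d) → ℝ) (hμ : ∀ z, 0 < μ z) :
    modNorm2 d g μ f = (∫⁻ x, ∫⁻ ω, ENNReal.ofReal (μ (x, ω) ^ 2) * ‖stft d g f x ω‖ₑ ^ 2)
      ^ (1 / (2 : ℝ)) := by
  unfold modNorm2
  congr 3
  ext x
  congr 1
  ext ω
  rw [ENNReal.ofReal_mul (hμ _).le, ofReal_norm, ENNReal.ofReal_pow (hμ _).le, ← mul_pow,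
    ← ENNReal.rpow_natCast]
  norm_num

end Concrete

section Assembly
variable {E : Type*} [NormedAddCommGroup E] [InnerProductSpace ℝ E] [FiniteDimensional ℝ E]
    [MeasurableSpace E] [BorelSpace E]

/-- The properties of the triple `(|f|², |f̂|², |V_g f|²)` that are used. -/
def Tup (k kh u uh : E → ℝ≥0∞) (W : E → E → ℝ≥0∞) : Prop :=
  Measurable u ∧ Measurable uh ∧ Measurable (Function.uncurry W) ∧
    (∀ x, ∫⁻ ω, W x ω = ∫⁻ t, u t * k (t - x)) ∧
    (∀ ω, ∫⁻ x, W x ω = ∫⁻ ξ, uh ξ * kh (ξ - ω)) ∧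
    ∫⁻ x, u x = ∫⁻ ξ, uh ξ ∧ (∀ R : ℝ, ∫⁻ ξ in Metric.closedBall 0 R, uh ξ ≠ ⊤)

/-- The squared combined norm. -/
noncomputable def Ssum (A : E → E → ℝ) (P Q : E → ℝ) (u uh : E → ℝ≥0∞) (W : E → E → ℝ≥0∞) : ℝ≥0∞ :=
  (∫⁻ x, ∫⁻ ω, ENNReal.ofReal (A x ω) * W x ω) + (∫⁻ x, ENNReal.ofReal (P x) * u x) +
    (∫⁻ ξ, ENNReal.ofReal (Q ξ) * uh ξ)

lemma lower_const_ne_top (k : E → ℝ≥0∞) (n : ℕ) (hk : Measurable k) (hk0 : ∫⁻ y, k y ≠ 0) :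
    (∫⁻ y, (pw n y)⁻¹ * k y)⁻¹ ≠ ⊤ := by
  rw [Ne, ENNReal.inv_eq_top]
  intro h0
  apply hk0
  have := pw_measurable (E := E) n
  rw [lintegral_eq_zero_iff (by fun_prop)] at h0
  rw [lintegral_eq_zero_iff hk]
  filter_upwards [h0] with y hy
  simpa [pw_ne_top] using hy

lemma whole_le (u : E → ℝ≥0∞) (P : E → ℝ) (p : ℝ) (hp : 0 < p) (hu : Measurable u)
    (hP : ∀ x, p ≤ P x) :
    ∫⁻ x, u x ≤ (ENNReal.ofReal p)⁻¹ * ∫⁻ x, ENNReal.ofReal (P x) * u x := by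
  have := tail_le u (fun x => ENNReal.ofReal (P x)) (ENNReal.ofReal p) (-1) (by simpa using hp)
    (by simp) hu (fun x _ => ENNReal.ofReal_le_ofReal (hP x))
  simpa [Metric.closedBall_eq_empty.2 (show (-1 : ℝ) < 0 by norm_num)] using this

lemma abstract_equiv (A M : E → E → ℝ) (P Q : E → ℝ) (K R : ℝ) (n : ℕ) (k kh : E → ℝ≥0∞)
    (hAc : Continuous (Function.uncurry A)) (hA0 : ∀ x ω, 0 < A x ω)
    (hPc : Continuous P) (hQc : Continuous Q) (hP : ∀ x, 0 ≤ P x) (hQ : ∀ x, 0 ≤ Q x)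
    (hM : ∀ x ω, M x ω = A x ω + P x + Q ω) (hK : 0 < K) (hR : 0 ≤ R)
    (hmod : ∀ x y ω, M x ω ≤ K * (1 + ‖x - y‖) ^ n * M y ω)
    (hmod' : ∀ x ω η, M x ω ≤ K * (1 + ‖ω - η‖) ^ n * M x η)
    (hinf : ∀ x ω, R ≤ ‖x‖ → M x ω ≤ 2 * (P x + Q ω))
    (hinf' : ∀ x ω, R ≤ ‖ω‖ → M x ω ≤ 2 * (P x + Q ω))
    (hk : Measurable k) (hkh : Measurable kh)
    (hk0 : ∫⁻ y, k y ≠ 0) (hkh0 : ∫⁻ y, kh y ≠ 0)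
    (hkt : ∀ n, ∫⁻ y, pw n y * k y ≠ ⊤) (hkht : ∀ n, ∫⁻ y, pw n y * kh y ≠ ⊤) :
    ∃ C D : ℝ≥0∞, C ≠ ⊤ ∧ D ≠ ⊤ ∧ ∀ u uh W, Tup k kh u uh W →
      (∫⁻ x, ∫⁻ ω, ENNReal.ofReal (M x ω) * W x ω) ≤ C * Ssum A P Q u uh W ∧
      Ssum A P Q u uh W ≤ D * ∫⁻ x, ∫⁻ ω, ENNReal.ofReal (M x ω) * W x ω := by
  have hMc : Continuous (Function.uncurry M) := by
    have : Function.uncurry M = fun z => Function.uncurry A z + P z.1 + Q z.2 := by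
      ext ⟨x, ω⟩; simp [hM]
    rw [this]; fun_prop
  have hMc1 : ∀ ω, Continuous (fun x => M x ω) := fun ω =>
    hMc.comp (continuous_id.prodMk continuous_const)
  have hMc2 : ∀ x, Continuous (fun ω => M x ω) := fun x =>
    hMc.comp (continuous_const.prodMk continuous_id)
  have hPM : ∀ x ω, P x ≤ M x ω := fun x ω => by rw [hM]; linarith [hA0 x ω, hQ ω]
  have hQM : ∀ x ω, Q ω ≤ M x ω := fun x ω => by rw [hM]; linarith [hA0 x ω, hP x]
  have hAM : ∀ x ω, A x ω ≤ M x ω := fun x ω => by rw [hM]; linarith [hQ ω, hP x]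
  have h1t : ∀ k : E → ℝ≥0∞, (∫⁻ y, pw 0 y * k y ≠ ⊤) → ∫⁻ y, k y ≠ ⊤ := by
    intro k h; simpa [pw] using h
  have hAb : ∀ R : ℝ, ∃ a : ℝ≥0∞, a ≠ 0 ∧ a ≠ ⊤ ∧
      ∀ x ω, ‖x‖ ≤ R → ‖ω‖ ≤ R → a ≤ ENNReal.ofReal (A x ω) := by
    intro R
    obtain ⟨z, -, hz⟩ := (isCompact_closedBall (0 : E × E) |R|).exists_isMinOn
      ⟨0, by simp⟩ hAc.continuousOn
    refine ⟨ENNReal.ofReal (A z.1 z.2), by simpa using hA0 _ _, by simp, fun x ω hx hω => ?_⟩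
    apply ENNReal.ofReal_le_ofReal
    refine hz (a := (x, ω)) ?_
    have := le_abs_self R
    simp only [Metric.mem_closedBall, dist_zero_right, Prod.norm_def]
    exact max_le (hx.trans this) (hω.trans this)
  -- bound on the whole L² norm when needed
  have ubQ : (∃ p : ℝ, 0 < p ∧ ∀ ω, p ≤ Q ω) →
      ∃ C : ℝ≥0∞, C ≠ ⊤ ∧ ∀ u uh W, Tup k kh u uh W → ∫⁻ x, u x ≤ C * Ssum A P Q u uh W := by
    rintro ⟨p, hp, hpQ⟩
    refine ⟨(ENNReal.ofReal p)⁻¹, by simpa using hp, ?_⟩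
    rintro u uh W ⟨hu, huh, hW, I1, I2, hpl, hb⟩
    rw [hpl]
    refine (whole_le uh Q p hp huh hpQ).trans ?_
    exact mul_le_mul_right le_add_self _
  have ubP : (∃ p : ℝ, 0 < p ∧ ∀ ω, p ≤ P ω) →
      ∃ C : ℝ≥0∞, C ≠ ⊤ ∧ ∀ u uh W, Tup k kh u uh W → ∫⁻ x, u x ≤ C * Ssum A P Q u uh W := by
    rintro ⟨p, hp, hpQ⟩
    refine ⟨(ENNReal.ofReal p)⁻¹, by simpa using hp, ?_⟩
    rintro u uh W ⟨hu, huh, hW, I1, I2, hpl, hb⟩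
    refine (whole_le u P p hp hu hpQ).trans ?_
    exact mul_le_mul_right (le_add_self.trans le_self_add) _
  have ubT : (∃ c R' : ℝ, 0 < c ∧ ∀ x, R' ≤ ‖x‖ → c ≤ P x ∧ c ≤ Q x) →
      ∃ C : ℝ≥0∞, C ≠ ⊤ ∧ ∀ u uh W, Tup k kh u uh W → ∫⁻ x, u x ≤ C * Ssum A P Q u uh W := by
    rintro ⟨c, R', hc, h⟩
    obtain ⟨C, hC, hh⟩ := core (fun x ω => ENNReal.ofReal (A x ω)) (fun x => ENNReal.ofReal (P x))
      (fun x => ENNReal.ofReal (Q x)) k kh (ENNReal.ofReal c) R' hk hkh hk0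
      (h1t _ (hkt 0)) (h1t _ (hkht 0)) hAb (by simpa using hc) (by simp)
      (fun x hx => ENNReal.ofReal_le_ofReal (h x hx).1)
      (fun x hx => ENNReal.ofReal_le_ofReal (h x hx).2)
    refine ⟨C, hC, ?_⟩
    rintro u uh W ⟨hu, huh, hW, I1, I2, hpl, hb⟩
    exact hh u uh W hu huh hW I1 I2 hpl hb
  have claim1 : ∃ C : ℝ≥0∞, C ≠ ⊤ ∧ ∀ u uh W, Tup k kh u uh W →
      ∫⁻ x, ∫⁻ ω, ENNReal.ofReal (P x) * W x ω ≤ C * Ssum A P Q u uh W := by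
    have main : (∃ C : ℝ≥0∞, C ≠ ⊤ ∧ ∀ u uh W, Tup k kh u uh W →
        ∫⁻ x, u x ≤ C * Ssum A P Q u uh W) → ∃ C : ℝ≥0∞, C ≠ ⊤ ∧ ∀ u uh W, Tup k kh u uh W →
      ∫⁻ x, ∫⁻ ω, ENNReal.ofReal (P x) * W x ω ≤ C * Ssum A P Q u uh W := by
      rintro ⟨C, hC, h⟩
      obtain ⟨K', hK', h'⟩ := weight_W1 P Q M K R n (hMc1 0) hK.le hP hQ hPM hmod hinf
      refine ⟨ENNReal.ofReal K' * (∫⁻ y, pw n y * k y) * (1 + C), ?_, ?_⟩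
      · exact ENNReal.mul_ne_top (ENNReal.mul_ne_top (by simp) (hkt n)) (by simpa using hC)
      · intro u uh W hT
        have hh := h u uh W hT
        obtain ⟨hu, huh, hW, I1, I2, hpl, hb⟩ := hT
        exact half2 P hP hPc u k W K' n _ C hu hk hW I1 hK' h' (le_add_self.trans le_self_add) hh
    rcases weight_W2 P Q M K R n hQc hK hR hP hQ hPM hQM hmod hmod' hinf hinf' with h | h | h
    · obtain ⟨K', hK', h'⟩ := h
      refine ⟨ENNReal.ofReal K' * (∫⁻ y, pw n y * k y), ?_, ?_⟩
      · exact ENNReal.mul_ne_top (by simp) (hkt n)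
      · rintro u uh W ⟨hu, huh, hW, I1, I2, hpl, hb⟩
        exact half1 P hP hPc u k W K' n _ hu hk hW I1 hK' h' (le_add_self.trans le_self_add)
    · exact main (ubQ h)
    · exact main (ubT h)
  have claim2 : ∃ C : ℝ≥0∞, C ≠ ⊤ ∧ ∀ u uh W, Tup k kh u uh W →
      ∫⁻ ω, ∫⁻ x, ENNReal.ofReal (Q ω) * W x ω ≤ C * Ssum A P Q u uh W := by
    have main : (∃ C : ℝ≥0∞, C ≠ ⊤ ∧ ∀ u uh W, Tup k kh u uh W →
        ∫⁻ x, u x ≤ C * Ssum A P Q u uh W) → ∃ C : ℝ≥0∞, C ≠ ⊤ ∧ ∀ u uh W, Tup k kh u uh W →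
      ∫⁻ ω, ∫⁻ x, ENNReal.ofReal (Q ω) * W x ω ≤ C * Ssum A P Q u uh W := by
      rintro ⟨C, hC, h⟩
      obtain ⟨K', hK', h'⟩ := weight_W1 Q P (fun ω x => M x ω) K R n (hMc2 0) hK.le hQ hP
        (fun ω x => hQM x ω) (fun ω η x => hmod' x ω η)
        (fun ω x h => by rw [add_comm]; exact hinf' x ω h)
      refine ⟨ENNReal.ofReal K' * (∫⁻ y, pw n y * kh y) * (1 + C), ?_, ?_⟩
      · exact ENNReal.mul_ne_top (ENNReal.mul_ne_top (by simp) (hkht n)) (by simpa using hC)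
      · intro u uh W hT
        have hh := h u uh W hT
        obtain ⟨hu, huh, hW, I1, I2, hpl, hb⟩ := hT
        exact half2 Q hQ hQc uh kh (fun ω x => W x ω) K' n _ C huh hkh
          (hW.comp measurable_swap) I2 hK' h' le_add_self (hpl ▸ hh)
    rcases weight_W2 Q P (fun ω x => M x ω) K R n hPc hK hR hQ hP (fun ω x => hQM x ω)
      (fun ω x => hPM x ω) (fun ω η x => hmod' x ω η) (fun ω x y => hmod x y ω)
      (fun ω x h => by rw [add_comm]; exact hinf' x ω h)
      (fun ω x h => by rw [add_comm]; exact hinf x ω h) with h | h | h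
    · obtain ⟨K', hK', h'⟩ := h
      refine ⟨ENNReal.ofReal K' * (∫⁻ y, pw n y * kh y), ?_, ?_⟩
      · exact ENNReal.mul_ne_top (by simp) (hkht n)
      · rintro u uh W ⟨hu, huh, hW, I1, I2, hpl, hb⟩
        exact half1 Q hQ hQc uh kh (fun ω x => W x ω) K' n _ huh hkh
          (hW.comp measurable_swap) I2 hK' h' le_add_self
    · exact main (ubP h)
    · obtain ⟨c, R', hc, h⟩ := h
      exact main (ubT ⟨c, R', hc, fun x hx => (h x hx).symm⟩)
  obtain ⟨C1, hC1, h1⟩ := claim1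
  obtain ⟨C2, hC2, h2⟩ := claim2
  set D1 := (∫⁻ y, (pw n y)⁻¹ * k y)⁻¹ * ENNReal.ofReal K with hD1
  set D2 := (∫⁻ y, (pw n y)⁻¹ * kh y)⁻¹ * ENNReal.ofReal K with hD2
  have hD1t : D1 ≠ ⊤ := ENNReal.mul_ne_top (lower_const_ne_top k n hk hk0) (by simp)
  have hD2t : D2 ≠ ⊤ := ENNReal.mul_ne_top (lower_const_ne_top kh n hkh hkh0) (by simp)
  refine ⟨1 + C1 + C2, 1 + D1 + D2, by simp [hC1, hC2], by simp [hD1t, hD2t], ?_⟩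
  intro u uh W hT
  have a1 := h1 u uh W hT
  have a2 := h2 u uh W hT
  obtain ⟨hu, huh, hW, I1, I2, hpl, hb⟩ := hT
  have hW' : Measurable (fun z : E × E => W z.1 z.2) := hW
  have hAm : Measurable (fun z : E × E => A z.1 z.2) := hAc.measurable
  have hMm : Measurable (fun z : E × E => M z.1 z.2) := hMc.measurable
  have swapQ : ∫⁻ x, ∫⁻ ω, ENNReal.ofReal (Q ω) * W x ω =
      ∫⁻ ω, ∫⁻ x, ENNReal.ofReal (Q ω) * W x ω :=
    lintegral_lintegral_swap (by
      apply Measurable.aemeasurable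
      show Measurable (fun z : E × E => ENNReal.ofReal (Q z.2) * W z.1 z.2)
      fun_prop)
  have swapM : ∫⁻ x, ∫⁻ ω, ENNReal.ofReal (M x ω) * W x ω =
      ∫⁻ ω, ∫⁻ x, ENNReal.ofReal (M x ω) * W x ω :=
    lintegral_lintegral_swap (by
      apply Measurable.aemeasurable
      show Measurable (fun z : E × E => ENNReal.ofReal (M z.1 z.2) * W z.1 z.2)
      fun_prop)
  constructor
  · have hsplit : ∫⁻ x, ∫⁻ ω, ENNReal.ofReal (M x ω) * W x ω =
        (∫⁻ x, ∫⁻ ω, ENNReal.ofReal (A x ω) * W x ω) +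
        (∫⁻ x, ∫⁻ ω, ENNReal.ofReal (P x) * W x ω) +
        (∫⁻ x, ∫⁻ ω, ENNReal.ofReal (Q ω) * W x ω) := by
      have mW : ∀ x, Measurable (W x) := fun x => hW'.comp measurable_prodMk_left
      have mA : ∀ x, Measurable (A x) := fun x => hAm.comp measurable_prodMk_left
      have mI : ∀ F : E × E → ℝ≥0∞, Measurable F → Measurable fun x => ∫⁻ ω, F (x, ω) :=
        fun F hF => hF.lintegral_prod_right'
      have mIA := mI (fun z => ENNReal.ofReal (A z.1 z.2) * W z.1 z.2) (by fun_prop)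
      have mIP := mI (fun z => ENNReal.ofReal (P z.1) * W z.1 z.2) (by fun_prop)
      dsimp only at mIA mIP
      have mS : Measurable fun x => (∫⁻ ω, ENNReal.ofReal (A x ω) * W x ω) +
          (∫⁻ ω, ENNReal.ofReal (P x) * W x ω) := mIA.add mIP
      rw [← lintegral_add_left mIA, ← lintegral_add_left mS]
      congr 1
      ext x
      have mWx := mW x
      have mAx := mA x
      rw [← lintegral_add_left (by fun_prop), ← lintegral_add_left (by fun_prop)]
      congr 1
      ext ω
      rw [hM, ENNReal.ofReal_add (add_nonneg (hA0 x ω).le (hP x)) (hQ ω),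
        ENNReal.ofReal_add (hA0 x ω).le (hP x), add_mul, add_mul]
    rw [hsplit, add_mul, add_mul, one_mul, swapQ]
    refine add_le_add (add_le_add ?_ a1) a2
    exact le_self_add.trans le_self_add
  · have b1 := lowerhalf P hPc M hMc1 hPM u k W K n hu hk hW I1 hK.le hk0 (hkt n) hmod
    have b2 := lowerhalf Q hQc (fun ω x => M x ω) hMc2 (fun ω x => hQM x ω) uh kh
      (fun ω x => W x ω) K n huh hkh (hW.comp measurable_swap) I2 hK.le hkh0 (hkht n)
      (fun ω η x => hmod' x ω η)
    rw [← swapM] at b2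
    rw [add_mul, add_mul, one_mul]
    refine add_le_add (add_le_add ?_ b1) b2
    refine lintegral_mono fun x => lintegral_mono fun ω => ?_
    exact mul_le_mul_left (ENNReal.ofReal_le_ofReal (hAM x ω)) _
end Assembly

/-- For `m₀ ∈ 𝒫(ℝ^{2d})` and `m₀`-admissible weights `(ψ, φ)`, i.e.
`m = sqrt(m₀² + |ψ|² + |φ|²)` is polynomially moderate with `m₀/m ∈ L^∞₀`, the norm
`‖f‖_{M²_m}` is equivalent to `(‖f‖²_{M²_{m₀}} + ‖ψf‖²_{L²} + ‖φf̂‖²_{L²})^{1/2}`. -/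
theorem stmt_18 (d : ℕ)
    (m₀ m : EuclideanSpace ℝ (Fin d) × EuclideanSpace ℝ (Fin d) → ℝ)
    (ψ φ : EuclideanSpace ℝ (Fin d) → ℂ) (hψ : Continuous ψ) (hφ : Continuous φ)
    (hm₀ : IsPolyModerateWeight d m₀)
    (hm : ∀ x ω, m (x, ω) = Real.sqrt ((m₀ (x, ω)) ^ 2 + ‖ψ x‖ ^ 2 + ‖φ ω‖ ^ 2))
    (hmP : IsPolyModerateWeight d m)
    (hLinfty0 : Tendsto (fun z => m₀ z / m z) (cocompact _) (nhds 0))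
    (g : SchwartzMap (EuclideanSpace ℝ (Fin d)) ℂ) (hgne : g ≠ 0) :
    ∃ c C : ℝ≥0∞, 0 < c ∧ C < ⊤ ∧
      ∀ f : EuclideanSpace ℝ (Fin d) → ℂ, Integrable f volume →
        c * modNorm2 d (⇑g) m f ≤
            (modNorm2 d (⇑g) m₀ f ^ 2 + eLpNorm (fun x => ψ x * f x) 2 volume ^ 2 +
              eLpNorm (fun ω => φ ω * 𝓕 f ω) 2 volume ^ 2) ^ (1 / (2 : ℝ)) ∧
          (modNorm2 d (⇑g) m₀ f ^ 2 + eLpNorm (fun x => ψ x * f x) 2 volume ^ 2 +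
              eLpNorm (fun ω => φ ω * 𝓕 f ω) 2 volume ^ 2) ^ (1 / (2 : ℝ)) ≤
            C * modNorm2 d (⇑g) m f := by
  obtain ⟨K, n, hK, hmodz⟩ := moderate_sq m hmP
  have hm₀c := hm₀.1
  have hm₀p := hm₀.2.1
  have hmp := hmP.2.1
  have hM : ∀ x ω, m (x, ω) ^ 2 = m₀ (x, ω) ^ 2 + ‖ψ x‖ ^ 2 + ‖φ ω‖ ^ 2 := by
    intro x ω
    rw [hm, Real.sq_sqrt (by positivity)]
  obtain ⟨R, hR, hinf⟩ : ∃ R : ℝ, 0 ≤ R ∧ ∀ x ω, R ≤ ‖(x, ω)‖ →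
      m (x, ω) ^ 2 ≤ 2 * (‖ψ x‖ ^ 2 + ‖φ ω‖ ^ 2) := by
    have h1 : ∀ᶠ z in cocompact (EuclideanSpace ℝ (Fin d) × EuclideanSpace ℝ (Fin d)),
        m₀ z / m z < 1 / 2 := hLinfty0.eventually (gt_mem_nhds (by norm_num))
    rw [Filter.Eventually, mem_cocompact] at h1
    obtain ⟨t, ht, hts⟩ := h1
    obtain ⟨B, hB⟩ := ht.isBounded.subset_closedBall 0
    refine ⟨|B| + 1, by positivity, fun x ω hx => ?_⟩
    have h2 : (x, ω) ∈ tᶜ := by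
      intro h3
      have h4 := hB h3
      rw [Metric.mem_closedBall, dist_zero_right] at h4
      linarith [le_abs_self B]
    have h3 : m₀ (x, ω) / m (x, ω) < 1 / 2 := hts h2
    rw [div_lt_iff₀ (hmp _)] at h3
    have h4 := hm₀p (x, ω)
    have h5 := hM x ω
    nlinarith
  have hgh0 : ∫⁻ y, ‖(𝓕 g) y‖ₑ ^ 2 ≠ 0 := by
    have := plancherel_lintegral (g : EuclideanSpace ℝ (Fin d) → ℂ) g.integrable
    simp only [SchwartzMap.fourier_coe]
    rw [this]
    exact schwartz_k0 g hgne
  have hgc := g.continuous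
  have hghc := (𝓕 g).continuous
  obtain ⟨C, D, hC, hD, key⟩ := abstract_equiv (fun x ω => m₀ (x, ω) ^ 2) (fun x ω => m (x, ω) ^ 2)
    (fun x => ‖ψ x‖ ^ 2) (fun ω => ‖φ ω‖ ^ 2) K R n (fun y => ‖g y‖ₑ ^ 2) (fun y => ‖(𝓕 g) y‖ₑ ^ 2)
    (show Continuous (fun z : EuclideanSpace ℝ (Fin d) × EuclideanSpace ℝ (Fin d) =>
      m₀ (z.1, z.2) ^ 2) from hm₀c.pow 2) (fun x ω => pow_pos (hm₀p _) 2) (by fun_prop) (by fun_prop)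
    (fun x => by positivity) (fun x => by positivity) hM hK hR
    (fun x y ω => by
      have := hmodz (y, ω) (x - y, 0)
      simpa [Prod.norm_def] using this)
    (fun x ω η => by
      have := hmodz (x, η) (0, ω - η)
      simpa [Prod.norm_def] using this)
    (fun x ω h => hinf x ω (h.trans (le_max_left _ _)))
    (fun x ω h => hinf x ω (h.trans (le_max_right _ _)))
    (by fun_prop) (by fun_prop) (schwartz_k0 g hgne) hgh0 (schwartz_J g) (schwartz_J (𝓕 g))
  refine ⟨(C ^ (1 / (2 : ℝ)))⁻¹, D ^ (1 / (2 : ℝ)), ?_, ?_, ?_⟩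
  · exact ENNReal.inv_pos.2 (ENNReal.rpow_ne_top_of_nonneg (by norm_num) hC)
  · exact (ENNReal.rpow_ne_top_of_nonneg (by norm_num) hD).lt_top
  intro f hf
  obtain ⟨f', hf', hff⟩ := hf.aestronglyMeasurable
  have hf'i : Integrable f' := hf.congr hff
  have hst := stft_congr_ae g f f' hff
  have hFc := fourier_continuous_of_integrable f hf
  have hFF : 𝓕 f = 𝓕 f' := by
    ext ω
    rw [Real.fourier_eq, Real.fourier_eq]
    apply integral_congr_ae
    filter_upwards [hff] with t ht
    rw [ht]
  have hT : Tup (fun y => ‖g y‖ₑ ^ 2) (fun y => ‖(𝓕 g) y‖ₑ ^ 2) (fun x => ‖f' x‖ₑ ^ 2)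
      (fun ξ => ‖𝓕 f ξ‖ₑ ^ 2) (fun x ω => ‖stft d g f x ω‖ₑ ^ 2) := by
    refine ⟨?_, ?_, stft_measurable g f hf, ?_, fun ω => stft_I2 g f hf ω, ?_, ?_⟩
    · have := hf'.measurable
      fun_prop
    · fun_prop
    · intro x
      rw [hst]
      exact stft_I1 g f' hf'i x
    · rw [hFF]
      exact (plancherel_lintegral f' hf'i).symm
    · intro r
      have hi : IntegrableOn (fun ξ => ‖𝓕 f ξ‖ ^ 2) (Metric.closedBall 0 r) :=
        (by fun_prop : Continuous (fun ξ => ‖𝓕 f ξ‖ ^ 2)).continuousOn.integrableOn_compact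
          (isCompact_closedBall _ _)
      refine ne_top_of_le_ne_top hi.lintegral_lt_top.ne (lintegral_mono fun ξ => ?_)
      rw [ENNReal.ofReal_pow (norm_nonneg _), ofReal_norm]
  obtain ⟨k1, k2⟩ := key _ _ _ hT
  have hS : modNorm2 d (⇑g) m₀ f ^ 2 + eLpNorm (fun x => ψ x * f x) 2 volume ^ 2 +
      eLpNorm (fun ω => φ ω * 𝓕 f ω) 2 volume ^ 2 =
      Ssum (fun x ω => m₀ (x, ω) ^ 2) (fun x => ‖ψ x‖ ^ 2) (fun ω => ‖φ ω‖ ^ 2)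
        (fun x => ‖f' x‖ₑ ^ 2) (fun ξ => ‖𝓕 f ξ‖ₑ ^ 2) (fun x ω => ‖stft d g f x ω‖ₑ ^ 2) := by
    have e1 : eLpNorm (fun x => ψ x * f x) 2 volume = eLpNorm (fun x => ψ x * f' x) 2 volume := by
      apply eLpNorm_congr_ae
      filter_upwards [hff] with t ht
      rw [ht]
    have e2 : ∀ a b : ℂ, ‖a * b‖ₑ ^ 2 = ENNReal.ofReal (‖a‖ ^ 2) * ‖b‖ₑ ^ 2 := by
      intro a b
      rw [enorm_mul, mul_pow, ENNReal.ofReal_pow (norm_nonneg _), ofReal_norm]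
    rw [e1, eLpNorm_two_sq', eLpNorm_two_sq', modNorm2_sq _ _ _ hm₀p, Ssum,
      ← ENNReal.rpow_natCast, ← ENNReal.rpow_mul]
    simp only [e2]
    norm_num
  rw [hS, modNorm2_sq _ _ _ hmp]
  constructor
  · rw [mul_comm, ← div_eq_mul_inv]
    apply ENNReal.div_le_of_le_mul
    rw [mul_comm, ← ENNReal.mul_rpow_of_nonneg _ _ (by norm_num)]
    exact ENNReal.rpow_le_rpow k1 (by norm_num)
  · rw [← ENNReal.mul_rpow_of_nonneg _ _ (by norm_num)]
    exact ENNReal.rpow_le_rpow k2 (by norm_num)
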